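/- arXiv:2603.19806 — 3 statements merged into one kernel-verified Lean document; each statement's English description precedes it below -/
import Mathlib

section
/- Let k ∈ ℕ, let P be any deterministic parity automaton recognizing the chain language L(M^k_1,…,M^k_k), and let (Q',δ') be an SCC of P consisting only of reachable states such that, for some 1 ≤ i < k and 1 ≤ j < k, for every word w using only letters from {x_i,…,x_{k+1}} ∪ {y_j,…,y_{k+1}}, every run on w starting in any state of Q' stays within (Q',δ'). Then there exist two disjoint SCCs (Q'ˣ,δ'ˣ) and (Q'ʸ,δ'ʸ) contained in (Q',δ'), consisting of reachable states, such that every run starting in a state of Q'ˣ on a word using only letters from {x_{max(i,j)+1},…,x_{k+1}} ∪ {y_j,…,y_{k+1}} stays within (Q'ˣ,δ'ˣ), and every run starting in a state of Q'ʸ on a word using only letters from {x_i,…,x_{k+1}} ∪ {y_{max(i,j)+1},…,y_{k+1}} stays within (Q'ʸ,δ'ʸ). -/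
open Classical

/-! ## Infinite words, residuals, injections, natural colors -/

abbrev Word (α : Type) : Type := ℕ → α

def wcat {α : Type} (l : List α) (w : Word α) : Word α :=
  fun n => if h : n < l.length then l.get ⟨n, h⟩ else w (n - l.length)

/-- The residual language of `L` over the finite word `l`. -/
def Residual {α : Type} (L : Set (Word α)) (l : List α) : Set (Word α) :=
  {w | wcat l w ∈ L}

def IsPrefixOfWord {α : Type} (l : List α) (w : Word α) : Prop :=
  ∀ (j : ℕ) (h : j < l.length), l.get ⟨j, h⟩ = w j

/-- The finite prefix `w₀ u₀ w₁ u₁ … u_{i-1} w_i` of the word obtained from `w`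
by injecting the finite word `u i` directly after position `i`. -/
def injPrefix {α : Type} (w : Word α) (u : ℕ → List α) : ℕ → List α
  | 0 => [w 0]
  | i + 1 => injPrefix w u i ++ u i ++ [w (i + 1)]

/-- `w'` results from `w` by residual-language-invariant (w.r.t. `L`) injections
of finite words at positions in `J`. -/
def ResultsFromInj {α : Type} (L : Set (Word α)) (J : Set ℕ) (w w' : Word α) : Prop :=
  ∃ u : ℕ → List α,
    (∀ i, i ∉ J → u i = []) ∧
    (∀ i, Residual L (injPrefix w u i) = Residual L (injPrefix w u i ++ u i)) ∧
    (∀ i, IsPrefixOfWord (injPrefix w u i ++ u i) w')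

/-- The word `w` is at home in color `i` with respect to `L`. -/
def AtHome {α : Type} (L : Set (Word α)) : ℕ → Word α → Prop
  | i, w =>
    ∃ J : Set ℕ, ∀ w', ResultsFromInj L J w w' →
      (∃ j, ∃ _ : j < i, AtHome L j w') ∨
      (w ∈ L ∧ w' ∈ L ∧ Even i) ∨
      (w ∉ L ∧ w' ∉ L ∧ ¬ Even i)
termination_by i _ => i

/-- The natural color of `w` w.r.t. `L`: the least color `w` is at home in. -/
noncomputable def NatColor {α : Type} (L : Set (Word α)) (w : Word α) : ℕ :=
  sInf {i | AtHome L i w}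

/-- The chain language of the (1-indexed) chain `C 1 ⊃ C 2 ⊃ … ⊃ C n`:
the words `w` such that the largest `i` with `w ∈ C i` is even, or `w ∉ C 1`. -/
def ChainLang {α : Type} (n : ℕ) (C : ℕ → Set (Word α)) : Set (Word α) :=
  {w | w ∉ C 1 ∨
       ∃ i, 1 ≤ i ∧ i ≤ n ∧ w ∈ C i ∧ Even i ∧ ∀ j, i < j → j ≤ n → w ∉ C j}

/-! ## Automata with transition-based acceptance -/

structure Automaton (α : Type) : Type 1 where
  Q : Type
  fin : Fintype Q
  init : Q
  trans : Q → α → Q → ℕ → Prop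

noncomputable def Automaton.size {α : Type} (A : Automaton α) : ℕ :=
  @Fintype.card A.Q A.fin

def IsRun {α : Type} (A : Automaton α) (w : Word α) (π : ℕ → A.Q) (ρ : ℕ → ℕ) : Prop :=
  π 0 = A.init ∧ ∀ i, A.trans (π i) (w i) (π (i + 1)) (ρ i)

def InfOcc (ρ : ℕ → ℕ) : Set ℕ := {c | ∀ N, ∃ n, N ≤ n ∧ ρ n = c}

/-- The least color occurring infinitely often exists and is even. -/
def AccColorSeq (ρ : ℕ → ℕ) : Prop :=
  ∃ c ∈ InfOcc ρ, Even c ∧ ∀ c' ∈ InfOcc ρ, c ≤ c'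

def Accepts {α : Type} (A : Automaton α) (w : Word α) : Prop :=
  ∃ π ρ, IsRun A w π ρ ∧ AccColorSeq ρ

def Lang {α : Type} (A : Automaton α) : Set (Word α) := {w | Accepts A w}

/-- Input-completeness plus: the color only depends on the source state and letter. -/
def IsParity {α : Type} (A : Automaton α) : Prop :=
  (∀ q x, ∃ q' c, A.trans q x q' c) ∧
  (∀ q x q₁ c₁ q₂ c₂, A.trans q x q₁ c₁ → A.trans q x q₂ c₂ → c₁ = c₂)

def Deterministic {α : Type} (A : Automaton α) : Prop :=
  ∀ q x, ∃! p : A.Q × ℕ, A.trans q x p.1 p.2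

def IsDPW {α : Type} (A : Automaton α) : Prop := IsParity A ∧ Deterministic A

def IsCoBuchi {α : Type} (A : Automaton α) : Prop :=
  IsParity A ∧ ∀ q x q' c, A.trans q x q' c → c = 1 ∨ c = 2

def IsDCW {α : Type} (A : Automaton α) : Prop := IsCoBuchi A ∧ Deterministic A

def adviceRun {α : Type} (A : Automaton α) (f : List α → A.Q) (w : Word α) : ℕ → A.Q
  | 0 => A.init
  | i + 1 => f (List.ofFn (fun j : Fin (i + 1) => w j.val))

/-- History-determinism via an advice function `f : α* → Q`. -/
def HistoryDet {α : Type} (A : Automaton α) : Prop :=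
  ∃ f : List α → A.Q, ∀ w : Word α,
    ∃ ρ, IsRun A w (adviceRun A f w) ρ ∧ (AccColorSeq ρ ↔ w ∈ Lang A)

/-- History-deterministic co-Büchi automaton with transition-based acceptance. -/
def IsHDCBW {α : Type} (A : Automaton α) : Prop := IsCoBuchi A ∧ HistoryDet A

def ReachableState {α : Type} (A : Automaton α) (q : A.Q) : Prop :=
  Relation.ReflTransGen (fun a b => ∃ x c, A.trans a x b c) A.init q

def TransStep {Q α : Type} (T : Set (Q × α × Q × ℕ)) (q q' : Q) : Prop :=
  ∃ x c, (q, x, q', c) ∈ T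

/-- `(S, T)` is a (nonempty) strongly connected component of `A`. -/
def IsSCC {α : Type} (A : Automaton α) (S : Set A.Q) (T : Set (A.Q × α × A.Q × ℕ)) : Prop :=
  S.Nonempty ∧
  (∀ t ∈ T, A.trans t.1 t.2.1 t.2.2.1 t.2.2.2) ∧
  (∀ t ∈ T, t.1 ∈ S ∧ t.2.2.1 ∈ S) ∧
  (∀ q ∈ S, ∀ q' ∈ S, Relation.ReflTransGen (TransStep T) q q')

/-- Every run on a word over the allowed letters that starts in `S`
stays within the subgraph `(S, T)`. -/
def RunStaysWithin {α : Type} (A : Automaton α) (S : Set A.Q)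
    (T : Set (A.Q × α × A.Q × ℕ)) (Allowed : Set α) : Prop :=
  ∀ w : Word α, (∀ n, w n ∈ Allowed) →
    ∀ (π : ℕ → A.Q) (ρ : ℕ → ℕ), π 0 ∈ S →
      (∀ i, A.trans (π i) (w i) (π (i + 1)) (ρ i)) →
      ∀ i, π i ∈ S ∧ (π i, w i, π (i + 1), ρ i) ∈ T
/-! ## Statement 0: the one-state parity language over {1,…,k} -/

/-- Words over `{1,…,k}` (letter `m : Fin k` denotes the number `m+1`) whose
minimal infinitely often occurring letter is even. -/
def ParityMinLang (k : ℕ) : Set (Word (Fin k)) :=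
  {w | ∃ m : Fin k, (∀ N, ∃ n, N ≤ n ∧ w n = m) ∧ Even (m.val + 1) ∧
        ∀ m' : Fin k, (∀ N, ∃ n, N ≤ n ∧ w n = m') → m ≤ m'}

/-! ## Statements 2–4: the alphabet {x₁,…,x_{k+1}, y₁,…,y_{k+1}} -/

/-- `Sum.inl m` is the letter `x_{m+1}`, `Sum.inr m` the letter `y_{m+1}`. -/
abbrev Sig1 (k : ℕ) : Type := Fin (k + 1) ⊕ Fin (k + 1)

def isXle (k j : ℕ) (c : Sig1 k) : Prop := ∃ m : Fin (k + 1), c = Sum.inl m ∧ m.val + 1 ≤ j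
def isYle (k j : ℕ) (c : Sig1 k) : Prop := ∃ m : Fin (k + 1), c = Sum.inr m ∧ m.val + 1 ≤ j
def isXge (k i : ℕ) (c : Sig1 k) : Prop := ∃ m : Fin (k + 1), c = Sum.inl m ∧ i ≤ m.val + 1
def isYge (k i : ℕ) (c : Sig1 k) : Prop := ∃ m : Fin (k + 1), c = Sum.inr m ∧ i ≤ m.val + 1

/-- `M^k_j`: the letters `x₁,…,x_j` together occur only finitely often, or
the letters `y₁,…,y_j` together occur only finitely often. -/
def Mlang (k j : ℕ) : Set (Word (Sig1 k)) :=
  {w | (∃ N, ∀ n, N ≤ n → ¬ isXle k j (w n)) ∨ (∃ N, ∀ n, N ≤ n → ¬ isYle k j (w n))}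

/-! ## Statements 5–16: the alphabet {X₁,…,X_k, Y₁,…,Y_k, a₀,…,a_{4k−1}} -/

/-- `Sum.inl m` is `X_{m+1}`, `Sum.inr (Sum.inl m)` is `Y_{m+1}`,
`Sum.inr (Sum.inr m)` is the letter `a_m`. -/
abbrev Sig2 (k : ℕ) : Type := Fin k ⊕ (Fin k ⊕ Fin (4 * k))

def isX2 (k i : ℕ) (c : Sig2 k) : Prop := ∃ m : Fin k, c = Sum.inl m ∧ m.val + 1 = i
def isY2 (k j : ℕ) (c : Sig2 k) : Prop := ∃ m : Fin k, c = Sum.inr (Sum.inl m) ∧ m.val + 1 = j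
def isaLe2 (k j : ℕ) (c : Sig2 k) : Prop :=
  ∃ m : Fin (4 * k), c = Sum.inr (Sum.inr m) ∧ m.val ≤ j
def isaGe2 (k j : ℕ) (c : Sig2 k) : Prop :=
  ∃ m : Fin (4 * k), c = Sum.inr (Sum.inr m) ∧ j ≤ m.val

/-- `L^k_i`: the words that eventually contain only letters from `{a₀,…,a_{4k−2i}}`,
together with the words that contain an even number of `X_i` letters and eventually
contain only letters from `{a₀,…,a_{4k−2i+1}}`. -/
def LL (k i : ℕ) : Set (Word (Sig2 k)) :=
  {w | (∃ N, ∀ n, N ≤ n → isaLe2 k (4 * k - 2 * i) (w n)) ∨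
       ({n | isX2 k i (w n)}.Finite ∧ Even {n | isX2 k i (w n)}.ncard ∧
        ∃ N, ∀ n, N ≤ n → isaLe2 k (4 * k - 2 * i + 1) (w n))}

/-- `\hat L^k_j`: the words that eventually contain only letters from
`{a_{2j−1},…,a_{4k−1}}`, together with the words that contain an even number of
`Y_j` letters and eventually contain only letters from `{a_{2j−2},…,a_{4k−1}}`. -/
def LLhat (k j : ℕ) : Set (Word (Sig2 k)) :=
  {w | (∃ N, ∀ n, N ≤ n → isaGe2 k (2 * j - 1) (w n)) ∨
       ({n | isY2 k j (w n)}.Finite ∧ Even {n | isY2 k j (w n)}.ncard ∧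
        ∃ N, ∀ n, N ≤ n → isaGe2 k (2 * j - 2) (w n))}

def Lbig (k : ℕ) : Set (Word (Sig2 k)) := ChainLang k (LL k)
def Lbighat (k : ℕ) : Set (Word (Sig2 k)) := ChainLang k (LLhat k)

/-- `L^k_i` extended by `L^k_0 = Σ^ω`. -/
def LL0 (k i : ℕ) : Set (Word (Sig2 k)) := if i = 0 then Set.univ else LL k i
def LLhat0 (k j : ℕ) : Set (Word (Sig2 k)) := if j = 0 then Set.univ else LLhat k j

/-- `p` is the unique greatest index pair of `w`. -/
def GreatestPair (k : ℕ) (w : Word (Sig2 k)) (p : ℕ × ℕ) : Prop :=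
  p.1 ≤ k ∧ p.2 ≤ k ∧ w ∈ LL0 k p.1 ∧ w ∈ LLhat0 k p.2 ∧
  ∀ i' j', i' ≤ k → j' ≤ k → w ∈ LL0 k i' → w ∈ LLhat0 k j' → i' ≤ p.1 ∧ j' ≤ p.2

/-- The sets `Γ^k_u`. -/
def GammaSet (k u : ℕ) : Set (ℕ × ℕ) :=
  if Even u then
    {p | p.1 ≤ k ∧ p.2 ≤ k ∧ p.1 + p.2 = u ∧ Even p.1 ∧ Even p.2}
  else
    {p | p.1 ≤ k ∧ p.2 ≤ k ∧ u ≤ p.1 + p.2 ∧ p.1 + p.2 ≤ u + 1 ∧ (Odd p.1 ∨ Odd p.2)}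

/-- The number of occurrences of the letter `X_i` in a finite word. -/
def countX (k i : ℕ) (u : List (Sig2 k)) : ℕ :=
  u.countP (fun c => match c with
    | Sum.inl m => decide (m.val + 1 = i)
    | _ => false)

/-! ## Statements 17–19: the alphabet {X₁,…,X_k, Y₁,…,Y_k, a₁,…,a_{2k+1}} -/

/-- `Sum.inl m` is `X_{m+1}`, `Sum.inr (Sum.inl m)` is `Y_{m+1}`,
`Sum.inr (Sum.inr m)` is the letter `a_{m+1}`. -/
abbrev Sig3 (k : ℕ) : Type := Fin k ⊕ (Fin k ⊕ Fin (2 * k + 1))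

def isX3 (k i : ℕ) (c : Sig3 k) : Prop := ∃ m : Fin k, c = Sum.inl m ∧ m.val + 1 = i
def isXany3 (k : ℕ) (c : Sig3 k) : Prop := ∃ m : Fin k, c = Sum.inl m
def isY3 (k j : ℕ) (c : Sig3 k) : Prop := ∃ m : Fin k, c = Sum.inr (Sum.inl m) ∧ m.val + 1 = j
def isa3 (k j : ℕ) (c : Sig3 k) : Prop :=
  ∃ m : Fin (2 * k + 1), c = Sum.inr (Sum.inr m) ∧ m.val + 1 = j
def isaGe3 (k j : ℕ) (c : Sig3 k) : Prop :=
  ∃ m : Fin (2 * k + 1), c = Sum.inr (Sum.inr m) ∧ j ≤ m.val + 1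

/-- `N^k_i` (for `1 ≤ i ≤ k+1`): letters from `{X₁,…,X_k}` occur only finitely often,
and when `i ≥ 2` additionally letters from `{a_{2k−2i+5},…,a_{2k+1}}` occur only
finitely often and either `a_{2k−2i+4}` occurs only finitely often or `X_{i−1}`
does not occur after the first occurrence of `Y_{i−1}`. -/
def NN (k i : ℕ) : Set (Word (Sig3 k)) :=
  {w | (∃ N, ∀ n, N ≤ n → ¬ isXany3 k (w n)) ∧
       (2 ≤ i →
         ((∃ N, ∀ n, N ≤ n → ¬ isaGe3 k (2 * k + 5 - 2 * i) (w n)) ∧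
          ((∃ N, ∀ n, N ≤ n → ¬ isa3 k (2 * k + 4 - 2 * i) (w n)) ∨
           (∀ n, (∃ m, m < n ∧ isY3 k (i - 1) (w m)) → ¬ isX3 k (i - 1) (w n)))))}

def Lbig3 (k : ℕ) : Set (Word (Sig3 k)) := ChainLang (k + 1) (NN k)

/-- The words with natural color `0` w.r.t. the complement of `L^k`:
every `Y_i` occurs and `X_i` never occurs after the first occurrence of `Y_i`,
and letters from `{a_{2k}, a_{2k+1}}` occur infinitely often. -/
def hatL0 (k : ℕ) : Set (Word (Sig3 k)) :=
  {w | (∀ i, 1 ≤ i → i ≤ k →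
          (∃ n, isY3 k i (w n)) ∧
          (∀ n, (∃ m, m < n ∧ isY3 k i (w m)) → ¬ isX3 k i (w n))) ∧
       (∀ N, ∃ n, N ≤ n ∧ isaGe3 k (2 * k) (w n))}

/-! ## Runs of a deterministic transition structure -/

/-- The state sequence of the deterministic run from `q` on `w`. -/
def detRun {Q α : Type} (nxt : Q → α → Q) (q : Q) (w : Word α) : ℕ → Q
  | 0 => q
  | n + 1 => nxt (detRun nxt q w n) (w n)

/-- The colors seen when reading a finite word from a given state. -/
def colorList {Q α : Type} (nxt : Q → α → Q) (col : Q → α → ℕ) : Q → List α → List ℕ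
  | _, [] => []
  | q, x :: l => col q x :: colorList nxt col (nxt q x) l

theorem colorList_append {Q α : Type} (nxt : Q → α → Q) (col : Q → α → ℕ) (q : Q)
    (u v : List α) :
    colorList nxt col q (u ++ v) =
      colorList nxt col q u ++ colorList nxt col (u.foldl nxt q) v := by
  induction u generalizing q with
  | nil => rfl
  | cons x u ih => simp [colorList, ih]

theorem foldl_map_range {Q α : Type} (nxt : Q → α → Q) (q : Q) (w : Word α) (n : ℕ) :
    ((List.range n).map w).foldl nxt q = detRun nxt q w n := by
  induction n with
  | zero => rfl
  | succ n ih => simp [List.range_succ, List.foldl_append, ih, detRun]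

theorem colorList_map_range {Q α : Type} (nxt : Q → α → Q) (col : Q → α → ℕ) (q : Q)
    (w : Word α) (n : ℕ) :
    colorList nxt col q ((List.range n).map w) =
      (List.range n).map fun m => col (detRun nxt q w m) (w m) := by
  induction n with
  | zero => rfl
  | succ n ih =>
    rw [List.range_succ, List.map_append, colorList_append, ih, foldl_map_range]
    simp [colorList]

theorem detRun_cons {Q α : Type} (nxt : Q → α → Q) (q : Q) (w : Word α) (n : ℕ) :
    detRun nxt q w (n + 1) = detRun nxt (nxt q (w 0)) (fun m => w (m + 1)) n := by
  induction n with
  | zero => rfl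
  | succ n ih => rw [detRun, ih, detRun]

/-- A deterministic automaton is given by a successor and a color function. -/
theorem Deterministic.exists_step {α : Type} {A : Automaton α} (h : Deterministic A) :
    ∃ (nxt : A.Q → α → A.Q) (col : A.Q → α → ℕ),
      ∀ q x q' c, A.trans q x q' c ↔ q' = nxt q x ∧ c = col q x := by
  choose f hf huniq using h
  refine ⟨fun q x => (f q x).1, fun q x => (f q x).2, fun q x q' c => ⟨fun ht => ?_, ?_⟩⟩
  · have := huniq q x (q', c) ht
    exact ⟨congrArg Prod.fst this, congrArg Prod.snd this⟩
  · rintro ⟨rfl, rfl⟩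
    exact hf q x

theorem eq_detRun {Q α : Type} {nxt : Q → α → Q} {w : Word α} {π : ℕ → Q}
    (h : ∀ n, π (n + 1) = nxt (π n) (w n)) (n : ℕ) : π n = detRun nxt (π 0) w n := by
  induction n with
  | zero => rfl
  | succ n ih => rw [h, ih, detRun]

/-! ## Invariance under removing the first letter -/

theorem infOcc_shift (ρ : ℕ → ℕ) : InfOcc (fun n => ρ (n + 1)) = InfOcc ρ := by
  ext c
  constructor
  · intro h N
    obtain ⟨n, hn, hc⟩ := h N
    exact ⟨n + 1, by omega, hc⟩
  · intro h N
    obtain ⟨n, hn, hc⟩ := h (N + 1)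
    refine ⟨n - 1, by omega, ?_⟩
    show ρ (n - 1 + 1) = c
    rw [Nat.sub_add_cancel (by omega), hc]

theorem accColorSeq_shift (ρ : ℕ → ℕ) :
    AccColorSeq (fun n => ρ (n + 1)) ↔ AccColorSeq ρ := by
  simp only [AccColorSeq, infOcc_shift]

theorem eventually_not_shift {α : Type} (p : α → Prop) (w : Word α) :
    (∃ N, ∀ n, N ≤ n → ¬ p (w (n + 1))) ↔ ∃ N, ∀ n, N ≤ n → ¬ p (w n) := by
  constructor
  · rintro ⟨N, h⟩
    refine ⟨N + 1, fun n hn => ?_⟩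
    have := h (n - 1) (by omega)
    rwa [Nat.sub_add_cancel (by omega)] at this
  · rintro ⟨N, h⟩
    exact ⟨N, fun n hn => h (n + 1) (by omega)⟩

theorem mem_Mlang_shift {k j : ℕ} (w : Word (Sig1 k)) :
    (fun n => w (n + 1)) ∈ Mlang k j ↔ w ∈ Mlang k j :=
  or_congr (eventually_not_shift _ w) (eventually_not_shift _ w)

theorem mem_chainLang_Mlang_shift {k : ℕ} (w : Word (Sig1 k)) :
    (fun n => w (n + 1)) ∈ ChainLang k (Mlang k) ↔ w ∈ ChainLang k (Mlang k) := by
  simp only [ChainLang, Set.mem_ofPred_eq, mem_Mlang_shift]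

/-- From every reachable state, a deterministic automaton for `L(M₁, …, M_k)` accepts
the language itself. -/
theorem accColorSeq_detRun_iff {k : ℕ} {P : Automaton (Sig1 k)}
    (hlang : Lang P = ChainLang k (Mlang k)) {nxt : P.Q → Sig1 k → P.Q}
    {col : P.Q → Sig1 k → ℕ}
    (hstep : ∀ q x q' c, P.trans q x q' c ↔ q' = nxt q x ∧ c = col q x)
    {q : P.Q} (hq : ReachableState P q) (w : Word (Sig1 k)) :
    AccColorSeq (fun n => col (detRun nxt q w n) (w n)) ↔ w ∈ ChainLang k (Mlang k) := by
  induction hq generalizing w with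
  | refl =>
    rw [← hlang]
    constructor
    · intro h
      exact ⟨_, _, ⟨rfl, fun i => (hstep _ _ _ _).2 ⟨rfl, rfl⟩⟩, h⟩
    · rintro ⟨π, ρ, ⟨h0, hrun⟩, hacc⟩
      have hπ := eq_detRun fun n => ((hstep _ _ _ _).1 (hrun n)).1
      have hρ : ρ = fun n => col (detRun nxt P.init w n) (w n) := by
        funext n
        rw [((hstep _ _ _ _).1 (hrun n)).2, hπ n, h0]
      rwa [← hρ]
  | @tail b b' _ hb ih =>
    obtain ⟨x, c, hx⟩ := hb
    obtain ⟨rfl, -⟩ := (hstep _ _ _ _).1 hx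
    let w' : Word (Sig1 k) := fun n => Nat.casesOn n x w
    have key := ih w'
    rw [← accColorSeq_shift, ← mem_chainLang_Mlang_shift] at key
    simp only [detRun_cons] at key
    exact key

/-! ## Periodic words -/

theorem Function.Periodic.mem_infOcc_iff {ρ : ℕ → ℕ} {p : ℕ} (h : Function.Periodic ρ p)
    (hp : 0 < p) {c : ℕ} : c ∈ InfOcc ρ ↔ ∃ n, ρ n = c := by
  constructor
  · intro hc
    obtain ⟨n, -, hn⟩ := hc 0
    exact ⟨n, hn⟩
  · rintro ⟨n, rfl⟩ N
    refine ⟨n + N * p, ?_, h.nat_mul N n⟩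
    nlinarith

theorem Function.Periodic.eventually_not_iff {α : Type} {w : Word α} {p : ℕ}
    (h : Function.Periodic w p) (hp : 0 < p) (φ : α → Prop) :
    (∃ N, ∀ n, N ≤ n → ¬ φ (w n)) ↔ ∀ n, ¬ φ (w n) := by
  constructor
  · rintro ⟨N, hN⟩ n
    have := hN (n + N * p) (by nlinarith)
    rwa [show w (n + N * p) = w n from h.nat_mul N n] at this
  · intro hN
    exact ⟨0, fun n _ => hN n⟩

theorem Function.Periodic.mem_map_range_iff {α : Type} {f : ℕ → α} {p : ℕ}
    (h : Function.Periodic f p) (hp : 0 < p) {c : α} :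
    c ∈ (List.range p).map f ↔ ∃ n, f n = c := by
  simp only [List.mem_map, List.mem_range]
  constructor
  · rintro ⟨n, -, hn⟩
    exact ⟨n, hn⟩
  · rintro ⟨n, hn⟩
    exact ⟨n % p, Nat.mod_lt _ hp, by rw [h.map_mod_nat, hn]⟩

theorem exists_periodic_word {α : Type} {l : List α} (hl : l ≠ []) :
    ∃ w : Word α, Function.Periodic w l.length ∧ (List.range l.length).map w = l := by
  have hpos : 0 < l.length := List.length_pos_iff.2 hl
  refine ⟨fun n => l[n % l.length]'(Nat.mod_lt _ hpos), fun n => by simp, ?_⟩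
  refine List.ext_getElem (by simp) fun n h₁ h₂ => ?_
  simp [Nat.mod_eq_of_lt h₂]

theorem detRun_periodic {Q α : Type} {nxt : Q → α → Q} {q : Q} {w : Word α} {p : ℕ}
    (hw : Function.Periodic w p) (hq : detRun nxt q w p = q) :
    Function.Periodic (detRun nxt q w) p := by
  intro n
  induction n with
  | zero => rw [Nat.zero_add, hq, detRun]
  | succ n ih =>
    rw [show n + 1 + p = n + p + 1 by omega, detRun, detRun, ih, hw n]

/-! ## The chain language on periodic words -/

theorem mem_chainLang_iff {α : Type} {n : ℕ} {C : ℕ → Set (Word α)} {w : Word α} {d : ℕ}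
    (hn : 1 ≤ n) (hd : d ≤ n) (h : ∀ t, 1 ≤ t → t ≤ n → (w ∈ C t ↔ t ≤ d)) :
    w ∈ ChainLang n C ↔ Even d := by
  constructor
  · rintro (h1 | ⟨t, ht1, htn, htC, hte, htmax⟩)
    · have : d = 0 := by
        by_contra hd0
        exact h1 ((h 1 le_rfl hn).2 (by omega))
      simp [this]
    · have htd := (h t ht1 htn).1 htC
      rcases htd.eq_or_lt with rfl | hlt
      · exact hte
      · exact absurd ((h d (by omega) hd).2 le_rfl) (htmax d hlt hd)
  · intro he
    rcases Nat.eq_zero_or_pos d with rfl | hpos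
    · left
      rw [h 1 le_rfl hn]
      omega
    · refine Or.inr ⟨d, hpos, hd, (h d hpos hd).2 le_rfl, he, fun t hdt htn hC => ?_⟩
      have := (h t (by omega) htn).1 hC
      omega

/-- If a loop on a reachable state reads only letters from `{x_a, …} ∪ {y_b, …}`, among them
`x_a` and `y_b`, then its least color has the parity of `max a b - 1`. -/
theorem exists_least_color_of_loop {k : ℕ} {P : Automaton (Sig1 k)}
    (hlang : Lang P = ChainLang k (Mlang k)) {nxt : P.Q → Sig1 k → P.Q}
    {col : P.Q → Sig1 k → ℕ}
    (hstep : ∀ q x q' c, P.trans q x q' c ↔ q' = nxt q x ∧ c = col q x)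
    {q : P.Q} (hq : ReachableState P q) {l : List (Sig1 k)} (hloop : l.foldl nxt q = q)
    (hk : 1 ≤ k) {a b : ℕ} (hab : max a b ≤ k + 1)
    (hl : ∀ c ∈ l, isXge k a c ∨ isYge k b c)
    (ha : ∃ c ∈ l, isXle k a c) (hb : ∃ c ∈ l, isYle k b c) :
    ∃ c ∈ colorList nxt col q l, (∀ c' ∈ colorList nxt col q l, c ≤ c') ∧
      (Even c ↔ Even (max a b - 1)) := by
  have hne : l ≠ [] := by
    rintro rfl
    simp at ha
  have hpos : 0 < l.length := List.length_pos_iff.2 hne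
  obtain ⟨w, hw, hwl⟩ := exists_periodic_word hne
  have hrun : Function.Periodic (detRun nxt q w) l.length :=
    detRun_periodic hw (by rw [← foldl_map_range, hwl, hloop])
  let ρ : ℕ → ℕ := fun n => col (detRun nxt q w n) (w n)
  have hρ : Function.Periodic ρ l.length := fun n => by
    show col (detRun nxt q w (n + l.length)) (w (n + l.length)) = _
    rw [hrun n, hw n]
  have hmem : ∀ c, c ∈ colorList nxt col q l ↔ c ∈ InfOcc ρ := fun c => by
    rw [hρ.mem_infOcc_iff hpos, ← hρ.mem_map_range_iff hpos, ← colorList_map_range, hwl]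
  have hletter : ∀ c, c ∈ l ↔ ∃ n, w n = c := fun c => by
    rw [← hw.mem_map_range_iff hpos, hwl]
  have hchain : w ∈ ChainLang k (Mlang k) ↔ Even (max a b - 1) := by
    refine mem_chainLang_iff hk (by omega) fun t ht1 htk => ?_
    have hM : w ∈ Mlang k t ↔ (∀ n, ¬ isXle k t (w n)) ∨ ∀ n, ¬ isYle k t (w n) :=
      or_congr (hw.eventually_not_iff hpos _) (hw.eventually_not_iff hpos _)
    rw [hM]
    obtain ⟨ca, hca, ma, rfl, hma⟩ := ha
    obtain ⟨cb, hcb, mb, rfl, hmb⟩ := hb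
    obtain ⟨na, hna⟩ := (hletter _).1 hca
    obtain ⟨nb, hnb⟩ := (hletter _).1 hcb
    constructor
    · rintro (h | h)
      · have : ¬ a ≤ t := fun hat => h na ⟨ma, hna, by omega⟩
        omega
      · have : ¬ b ≤ t := fun hbt => h nb ⟨mb, hnb, by omega⟩
        omega
    · intro h
      rcases (show t < a ∨ t < b by omega) with hta | htb
      · refine Or.inl fun n => ?_
        rintro ⟨m, hm, hmt⟩
        rcases hl (w n) ((hletter _).2 ⟨n, rfl⟩) with ⟨m', hm', hm''⟩ | ⟨m', hm', hm''⟩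
        · rw [hm, Sum.inl.injEq] at hm'
          subst hm'
          omega
        · rw [hm] at hm'
          cases hm'
      · refine Or.inr fun n => ?_
        rintro ⟨m, hm, hmt⟩
        rcases hl (w n) ((hletter _).2 ⟨n, rfl⟩) with ⟨m', hm', hm''⟩ | ⟨m', hm', hm''⟩
        · rw [hm] at hm'
          cases hm'
        · rw [hm, Sum.inr.injEq] at hm'
          subst hm'
          omega
  have hacc : AccColorSeq ρ ↔ Even (max a b - 1) :=
    (accColorSeq_detRun_iff hlang hstep hq w).trans hchain
  have hex : ∃ c, c ∈ InfOcc ρ := ⟨ρ 0, (hρ.mem_infOcc_iff hpos).2 ⟨0, rfl⟩⟩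
  refine ⟨Nat.find hex, (hmem _).2 (Nat.find_spec hex),
    fun c' hc' => Nat.find_min' hex ((hmem _).1 hc'), ?_⟩
  rw [← hacc]
  constructor
  · intro he
    exact ⟨_, Nat.find_spec hex, he, fun c' hc' => Nat.find_min' hex hc'⟩
  · rintro ⟨c, hc, he, hmin⟩
    rwa [le_antisymm (Nat.find_min' hex hc) (hmin _ (Nat.find_spec hex))]

/-! ## Bottom components -/

/-- In a finite graph, every vertex reaches a vertex of a bottom component. -/
theorem exists_reflTransGen_bottom {Q : Type} [Finite Q] (R : Q → Q → Prop) (q₀ : Q) :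
    ∃ q, Relation.ReflTransGen R q₀ q ∧
      ∀ r, Relation.ReflTransGen R q r → Relation.ReflTransGen R r q := by
  obtain ⟨q, hq, hmin⟩ := Set.exists_min_image {q | Relation.ReflTransGen R q₀ q}
    (fun q => {r | Relation.ReflTransGen R q r}.ncard) (Set.toFinite _)
    ⟨q₀, Relation.ReflTransGen.refl⟩
  refine ⟨q, hq, fun r hr => ?_⟩
  have hsub : {s | Relation.ReflTransGen R r s} ⊆ {s | Relation.ReflTransGen R q s} :=
    fun s hs => hr.trans hs
  have heq := Set.eq_of_subset_of_ncard_le hsub (hmin r (hq.trans hr)) (Set.toFinite _)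
  have : q ∈ {s | Relation.ReflTransGen R q s} := Relation.ReflTransGen.refl
  rwa [← heq] at this

theorem exists_foldl_of_reflTransGen {Q α : Type} {nxt : Q → α → Q} {A : Set α} {q q' : Q}
    (h : Relation.ReflTransGen (fun a b => ∃ x ∈ A, b = nxt a x) q q') :
    ∃ l : List α, (∀ x ∈ l, x ∈ A) ∧ l.foldl nxt q = q' := by
  induction h with
  | refl => exact ⟨[], by simp, rfl⟩
  | tail _ hb ih =>
    obtain ⟨l, hlA, rfl⟩ := ih
    obtain ⟨x, hx, rfl⟩ := hb
    refine ⟨l ++ [x], fun y hy => ?_, by simp⟩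
    rcases List.mem_append.1 hy with hy | hy
    · exact hlA y hy
    · rw [List.mem_singleton.1 hy]
      exact hx

/-- An SCC that is closed under the letters in `B` contains an SCC that is closed under, and
strongly connected by, the letters in `A ⊆ B`. -/
theorem exists_closed_subSCC {α : Type} {P : Automaton α} {nxt : P.Q → α → P.Q}
    {col : P.Q → α → ℕ}
    (hstep : ∀ q x q' c, P.trans q x q' c ↔ q' = nxt q x ∧ c = col q x)
    {S : Set P.Q} {T : Set (P.Q × α × P.Q × ℕ)} (hS : S.Nonempty) {A B : Set α}
    (hAB : A ⊆ B) (hclosed : RunStaysWithin P S T B) :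
    ∃ (S' : Set P.Q) (T' : Set (P.Q × α × P.Q × ℕ)), IsSCC P S' T' ∧ S' ⊆ S ∧ T' ⊆ T ∧
      RunStaysWithin P S' T' A ∧ (∀ q ∈ S', ∀ x ∈ A, nxt q x ∈ S') ∧
      ∀ q ∈ S', ∀ q' ∈ S', ∃ l : List α, (∀ x ∈ l, x ∈ A) ∧ l.foldl nxt q = q' := by
  have : Finite P.Q := @Finite.of_fintype _ P.fin
  have hST : ∀ q ∈ S, ∀ x ∈ A, nxt q x ∈ S ∧ (q, x, nxt q x, col q x) ∈ T := by
    intro q hq x hx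
    have h := hclosed (fun _ => x) (fun _ => hAB hx) (detRun nxt q fun _ => x)
      (fun n => col (detRun nxt q (fun _ => x) n) x) hq
      fun i => (hstep _ _ _ _).2 ⟨rfl, rfl⟩
    exact ⟨(h 1).1, (h 0).2⟩
  obtain ⟨q₀, hq₀⟩ := hS
  let R : P.Q → P.Q → Prop := fun a b => ∃ x ∈ A, b = nxt a x
  obtain ⟨q, hq, hbot⟩ := exists_reflTransGen_bottom R q₀
  let S' : Set P.Q := {r | Relation.ReflTransGen R q r}
  let T' : Set (P.Q × α × P.Q × ℕ) :=
    {t | t.1 ∈ S' ∧ t.2.1 ∈ A ∧ P.trans t.1 t.2.1 t.2.2.1 t.2.2.2}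
  have hclosed' : ∀ r ∈ S', ∀ x ∈ A, nxt r x ∈ S' := fun r hr x hx =>
    Relation.ReflTransGen.tail hr ⟨x, hx, rfl⟩
  have hsub : S' ⊆ S := by
    intro r hr
    have hr' : Relation.ReflTransGen R q₀ r := hq.trans hr
    clear hr
    induction hr' with
    | refl => exact hq₀
    | tail _ hb ih =>
      obtain ⟨x, hx, rfl⟩ := hb
      exact (hST _ ih x hx).1
  have hconn : ∀ r ∈ S', ∀ r' ∈ S', Relation.ReflTransGen R r r' := fun r hr r' hr' =>
    (hbot r hr).trans hr'
  refine ⟨S', T', ⟨⟨q, Relation.ReflTransGen.refl⟩, fun t ht => ht.2.2, ?_, ?_⟩, hsub, ?_, ?_,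
    hclosed', fun r hr r' hr' => exists_foldl_of_reflTransGen (hconn r hr r' hr')⟩
  · rintro ⟨r, x, r', c⟩ ⟨hr, hx, ht⟩
    obtain ⟨rfl, -⟩ := (hstep r x r' c).1 ht
    exact ⟨hr, hclosed' r hr x hx⟩
  · intro r hr r' hr'
    have hrr' := hconn r hr r' hr'
    clear hr'
    induction hrr' with
    | refl => exact Relation.ReflTransGen.refl
    | tail h hb ih =>
      refine ih.tail ?_
      obtain ⟨x, hx, rfl⟩ := hb
      exact ⟨x, col _ x, (show Relation.ReflTransGen R q r from hr).trans h, hx,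
        (hstep _ _ _ _).2 ⟨rfl, rfl⟩⟩
  · rintro ⟨r, x, r', c⟩ ⟨hr, hx, ht⟩
    obtain ⟨rfl, rfl⟩ := (hstep r x r' c).1 ht
    exact (hST r (hsub hr) x hx).2
  · intro w hw π ρ h0 hrun
    have hπ : ∀ n, π n ∈ S' := by
      intro n
      induction n with
      | zero => exact h0
      | succ n ih =>
        rw [((hstep _ _ _ _).1 (hrun n)).1]
        exact hclosed' _ ih _ (hw n)
    exact fun n => ⟨hπ n, hπ n, hw n, hrun n⟩

/-- A strongly connected closed set of states has, at each state, a loop that starts with two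
prescribed letters. -/
theorem exists_loop_cons_cons {Q α : Type} {nxt : Q → α → Q} {S : Set Q} {A : Set α}
    (hclosed : ∀ q ∈ S, ∀ x ∈ A, nxt q x ∈ S)
    (hconn : ∀ q ∈ S, ∀ q' ∈ S, ∃ l : List α, (∀ x ∈ l, x ∈ A) ∧ l.foldl nxt q = q')
    {q : Q} (hq : q ∈ S) {x y : α} (hx : x ∈ A) (hy : y ∈ A) :
    ∃ l : List α, (∀ z ∈ l, z ∈ A) ∧ x ∈ l ∧ y ∈ l ∧ l.foldl nxt q = q := by
  obtain ⟨l, hl, hlq⟩ := hconn _ (hclosed _ (hclosed q hq x hx) y hy) q hq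
  refine ⟨x :: y :: l, ?_, by simp, by simp, hlq⟩
  intro z hz
  rcases List.mem_cons.1 hz with rfl | hz
  · exact hx
  rcases List.mem_cons.1 hz with rfl | hz
  · exact hy
  exact hl z hz

theorem isXge.mono {k a b : ℕ} (hab : a ≤ b) {c : Sig1 k} : isXge k b c → isXge k a c :=
  fun ⟨m, hm, h⟩ => ⟨m, hm, hab.trans h⟩

theorem isYge.mono {k a b : ℕ} (hab : a ≤ b) {c : Sig1 k} : isYge k b c → isYge k a c :=
  fun ⟨m, hm, h⟩ => ⟨m, hm, hab.trans h⟩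

theorem exists_isXge_isXle {k a : ℕ} (ha : 1 ≤ a) (hak : a ≤ k + 1) :
    ∃ c, isXge k a c ∧ isXle k a c :=
  have h : a - 1 + 1 = a := Nat.sub_add_cancel ha
  ⟨Sum.inl ⟨a - 1, by omega⟩, ⟨_, rfl, h.ge⟩, ⟨_, rfl, h.le⟩⟩

theorem exists_isYge_isYle {k a : ℕ} (ha : 1 ≤ a) (hak : a ≤ k + 1) :
    ∃ c, isYge k a c ∧ isYle k a c :=
  have h : a - 1 + 1 = a := Nat.sub_add_cancel ha
  ⟨Sum.inr ⟨a - 1, by omega⟩, ⟨_, rfl, h.ge⟩, ⟨_, rfl, h.le⟩⟩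

theorem scc_nesting_lemma (k : ℕ) (P : Automaton (Sig1 k))
    (hdpw : IsDPW P) (hlang : Lang P = ChainLang k (Mlang k))
    (S : Set P.Q) (T : Set (P.Q × Sig1 k × P.Q × ℕ))
    (hscc : IsSCC P S T) (hreach : ∀ q ∈ S, ReachableState P q)
    (i j : ℕ) (hi1 : 1 ≤ i) (hik : i < k) (hj1 : 1 ≤ j) (hjk : j < k)
    (hclosed : RunStaysWithin P S T {c | isXge k i c ∨ isYge k j c}) :
    ∃ (Sx : Set P.Q) (Tx : Set (P.Q × Sig1 k × P.Q × ℕ))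
      (Sy : Set P.Q) (Ty : Set (P.Q × Sig1 k × P.Q × ℕ)),
      IsSCC P Sx Tx ∧ IsSCC P Sy Ty ∧
      Sx ⊆ S ∧ Tx ⊆ T ∧ Sy ⊆ S ∧ Ty ⊆ T ∧
      (∀ q ∈ Sx, ReachableState P q) ∧ (∀ q ∈ Sy, ReachableState P q) ∧
      Disjoint Sx Sy ∧
      RunStaysWithin P Sx Tx {c | isXge k (max i j + 1) c ∨ isYge k j c} ∧
      RunStaysWithin P Sy Ty {c | isXge k i c ∨ isYge k (max i j + 1) c} := by
  obtain ⟨nxt, col, hstep⟩ := hdpw.2.exists_step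
  have hAx : {c | isXge k (max i j + 1) c ∨ isYge k j c} ⊆ {c | isXge k i c ∨ isYge k j c} :=
    fun c hc => hc.imp_left (isXge.mono (by omega))
  have hAy : {c | isXge k i c ∨ isYge k (max i j + 1) c} ⊆ {c | isXge k i c ∨ isYge k j c} :=
    fun c hc => hc.imp_right (isYge.mono (by omega))
  obtain ⟨Sx, Tx, hsccx, hSx, hTx, hstayx, hclx, hconnx⟩ :=
    exists_closed_subSCC hstep hscc.1 hAx hclosed
  obtain ⟨Sy, Ty, hsccy, hSy, hTy, hstayy, hcly, hconny⟩ :=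
    exists_closed_subSCC hstep hscc.1 hAy hclosed
  refine ⟨Sx, Tx, Sy, Ty, hsccx, hsccy, hSx, hTx, hSy, hTy, fun q hq => hreach q (hSx hq),
    fun q hq => hreach q (hSy hq), Set.disjoint_left.2 fun q hqx hqy => ?_, hstayx, hstayy⟩
  have hq := hreach q (hSx hqx)
  obtain ⟨x, hx, hx'⟩ := exists_isXge_isXle (k := k) (a := max i j + 1) (by omega) (by omega)
  obtain ⟨y, hy, hy'⟩ := exists_isYge_isYle (k := k) (a := j) hj1 (by omega)
  obtain ⟨x₂, hx₂, hx₂'⟩ := exists_isXge_isXle (k := k) (a := i) hi1 (by omega)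
  obtain ⟨y₂, hy₂, hy₂'⟩ :=
    exists_isYge_isYle (k := k) (a := max i j + 1) (by omega) (by omega)
  obtain ⟨u, huA, hxu, hyu, hu⟩ :=
    exists_loop_cons_cons hclx hconnx hqx (x := x) (y := y) (Or.inl hx) (Or.inr hy)
  obtain ⟨v, hvA, hxv, hyv, hv⟩ :=
    exists_loop_cons_cons hcly hconny hqy (x := x₂) (y := y₂) (Or.inl hx₂) (Or.inr hy₂)
  obtain ⟨cu, hcu, hcu', hcue⟩ := exists_least_color_of_loop hlang hstep hq hu (by omega)
    (by omega) huA ⟨x, hxu, hx'⟩ ⟨y, hyu, hy'⟩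
  obtain ⟨cv, hcv, hcv', hcve⟩ := exists_least_color_of_loop hlang hstep hq hv (by omega)
    (by omega) hvA ⟨x₂, hxv, hx₂'⟩ ⟨y₂, hyv, hy₂'⟩
  obtain ⟨c, hc, hc', hce⟩ := exists_least_color_of_loop (l := u ++ v) hlang hstep hq
    (by rw [List.foldl_append, hu, hv]) (by omega) (a := i) (b := j) (by omega)
    (fun z hz => (List.mem_append.1 hz).elim (fun h => hAx (huA z h)) fun h => hAy (hvA z h))
    ⟨x₂, List.mem_append_right _ hxv, hx₂'⟩ ⟨y, List.mem_append_left _ hyu, hy'⟩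
  rw [colorList_append, hu] at hc hc'
  rw [show max (max i j + 1) j - 1 = max i j by omega] at hcue
  rw [show max i (max i j + 1) - 1 = max i j by omega] at hcve
  have hcc : c = cu ∨ c = cv := by
    rcases List.mem_append.1 hc with h | h
    · exact Or.inl (le_antisymm (hc' _ (List.mem_append_left _ hcu)) (hcu' _ h))
    · exact Or.inr (le_antisymm (hc' _ (List.mem_append_right _ hcv)) (hcv' _ h))
  have hpar : Even c ↔ Even (max i j) := by
    rcases hcc with rfl | rfl
    · exact hcue
    · exact hcve
  have hflip := Nat.even_add_one (n := max i j - 1)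
  rw [show max i j - 1 + 1 = max i j by omega] at hflip
  tauto
end

section
/- For every k ∈ ℕ and every 1 ≤ i ≤ k, there exists a deterministic co-Büchi automaton with transition-based acceptance that has exactly two states and whose language is L^k_i. -/
open Classical

/-- The colors lie in `{1, 2}`, so the sequence is accepting iff it is eventually `2`. -/
theorem accColorSeq_iff_eventually_two {ρ : ℕ → ℕ} (h : ∀ n, ρ n = 1 ∨ ρ n = 2) :
    AccColorSeq ρ ↔ ∃ N, ∀ n, N ≤ n → ρ n = 2 := by
  constructor
  · rintro ⟨c, hc, hev, hmin⟩
    by_contra! hne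
    have h1 : (1 : ℕ) ∈ InfOcc ρ := fun N => by
      obtain ⟨n, hn, hn2⟩ := hne N
      exact ⟨n, hn, (h n).resolve_right hn2⟩
    have hle := hmin 1 h1
    obtain ⟨n, -, hn⟩ := hc 0
    have := h n
    obtain ⟨r, hr⟩ := hev
    omega
  · rintro ⟨N, hN⟩
    refine ⟨2, fun M => ⟨max M N, le_max_left _ _, hN _ (le_max_right _ _)⟩, even_two, ?_⟩
    intro c hc
    obtain ⟨n, hn, hnc⟩ := hc N
    exact (hnc ▸ hN n hn).ge

/-- The deterministic automaton with transition function `step` and coloring `col`. -/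
def ofStep {α Q : Type} [Fintype Q] (init : Q) (step : Q → α → Q) (col : Q → α → ℕ) :
    Automaton α where
  Q := Q
  fin := inferInstance
  init := init
  trans q x q' c := q' = step q x ∧ c = col q x

/-- The run of a transition function on a word. -/
def stepRun {α Q : Type} (init : Q) (step : Q → α → Q) (w : Word α) : ℕ → Q
  | 0 => init
  | n + 1 => step (stepRun init step w n) (w n)

section ofStep

variable {α Q : Type} [Fintype Q] {init : Q} {step : Q → α → Q} {col : Q → α → ℕ}

theorem ofStep_isDCW (hcol : ∀ q x, col q x = 1 ∨ col q x = 2) :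
    IsDCW (ofStep init step col) := by
  refine ⟨⟨⟨fun q x => ⟨step q x, col q x, rfl, rfl⟩, ?_⟩, ?_⟩, ?_⟩
  · rintro q x q₁ c₁ q₂ c₂ ⟨-, rfl⟩ ⟨-, rfl⟩
    rfl
  · rintro q x q' c ⟨-, rfl⟩
    exact hcol q x
  · intro q x
    refine ⟨(step q x, col q x), ⟨rfl, rfl⟩, ?_⟩
    rintro ⟨q', c⟩ ⟨hq, hc⟩
    exact Prod.ext hq hc

theorem accepts_ofStep_iff {w : Word α} :
    Accepts (ofStep init step col) w ↔
      AccColorSeq (fun n => col (stepRun init step w n) (w n)) := by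
  constructor
  · rintro ⟨π, ρ, ⟨h0, hs⟩, hacc⟩
    have hπ : ∀ n, π n = stepRun init step w n := by
      intro n
      induction n with
      | zero => exact h0
      | succ n ih =>
        have := (hs n).1
        rw [ih] at this
        exact this
    have hρ : ρ = fun n => col (stepRun init step w n) (w n) := by
      funext n
      rw [← hπ n]
      exact (hs n).2
    exact hρ ▸ hacc
  · exact fun h => ⟨stepRun init step w, _, ⟨rfl, fun n => ⟨rfl, rfl⟩⟩, h⟩

end ofStep

/-- The transition function on `Bool` that flips the state on letters satisfying `p`. -/
noncomputable def flipStep {α : Type} (p : α → Prop) (q : Bool) (x : α) : Bool :=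
  if p x then !q else q

theorem stepRun_flipStep {α : Type} (p : α → Prop) (w : Word α) (n : ℕ) :
    stepRun true (flipStep p) w n = true ↔
      Even ((Finset.range n).filter fun m => p (w m)).card := by
  induction n with
  | zero => simp [stepRun]
  | succ n ih =>
    rw [Finset.range_add_one, Finset.filter_insert]
    by_cases h : p (w n)
    · rw [if_pos h, Finset.card_insert_of_notMem (by simp), Nat.even_add_one, ← ih]
      simp [stepRun, flipStep, h]
    · rw [if_neg h, ← ih]
      simp [stepRun, flipStep, h]

/-- If no letter of `w` from position `N` on satisfies `p`, then from `N` on the state of the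
flipping automaton is the parity of the total number of letters satisfying `p`. -/
theorem stepRun_flipStep_eventually {α : Type} {p : α → Prop} {w : Word α} {N : ℕ}
    (hN : ∀ n, N ≤ n → ¬ p (w n)) {n : ℕ} (hn : N ≤ n) :
    stepRun true (flipStep p) w n = true ↔ Even {m | p (w m)}.ncard := by
  have hset : {m | p (w m)} = ((Finset.range n).filter fun m => p (w m) : Finset ℕ) := by
    ext m
    simp only [Set.mem_ofPred_eq, Finset.coe_filter, Finset.mem_range]
    exact ⟨fun hm => ⟨lt_of_not_ge fun h => hN m (hn.trans h) hm, hm⟩, And.right⟩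
  rw [stepRun_flipStep, hset, Set.ncard_coe_finset]

theorem not_isX2_of_isaLe2 {k i j : ℕ} {c : Sig2 k} (h : isaLe2 k j c) : ¬ isX2 k i c := by
  rintro ⟨m, rfl, -⟩
  obtain ⟨m', hm', -⟩ := h
  cases hm'

theorem isaLe2_mono {k j j' : ℕ} {c : Sig2 k} (hj : j ≤ j') (h : isaLe2 k j c) :
    isaLe2 k j' c := by
  obtain ⟨m, rfl, hm⟩ := h
  exact ⟨m, rfl, hm.trans hj⟩

/-- The color is accepting on `a₀,…,a_{4k−2i}`, and on `a_{4k−2i+1}` in the state recording that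
the number of letters `X_i` read so far is even. -/
noncomputable def colLL (k i : ℕ) (q : Bool) (x : Sig2 k) : ℕ :=
  if isaLe2 k (4 * k - 2 * i) x ∨ (q = true ∧ isaLe2 k (4 * k - 2 * i + 1) x) then 2 else 1

theorem colLL_eq_two_iff {k i : ℕ} {q : Bool} {x : Sig2 k} :
    colLL k i q x = 2 ↔
      isaLe2 k (4 * k - 2 * i) x ∨ (q = true ∧ isaLe2 k (4 * k - 2 * i + 1) x) := by
  unfold colLL
  split_ifs with h <;> simp [h]

theorem colLL_eq_one_or_two (k i : ℕ) (q : Bool) (x : Sig2 k) :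
    colLL k i q x = 1 ∨ colLL k i q x = 2 := by
  unfold colLL
  split_ifs <;> simp

theorem twoState_dcw_for_LL (k i : ℕ) (h1 : 1 ≤ i) (h2 : i ≤ k) :
    ∃ A : Automaton (Sig2 k), IsDCW A ∧ A.size = 2 ∧ Lang A = LL k i := by
  refine ⟨ofStep true (flipStep (isX2 k i)) (colLL k i),
    ofStep_isDCW (colLL_eq_one_or_two k i), Fintype.card_bool, ?_⟩
  ext w
  change Accepts _ w ↔ _
  rw [accepts_ofStep_iff, accColorSeq_iff_eventually_two fun n => colLL_eq_one_or_two _ _ _ _]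
  simp only [colLL_eq_two_iff]
  constructor
  · rintro ⟨N, hN⟩
    have hle : ∀ n, N ≤ n → isaLe2 k (4 * k - 2 * i + 1) (w n) := fun n hn =>
      (hN n hn).elim (isaLe2_mono (Nat.le_succ _)) And.right
    have hX : ∀ n, N ≤ n → ¬ isX2 k i (w n) := fun n hn => not_isX2_of_isaLe2 (hle n hn)
    by_cases hev : Even {m | isX2 k i (w m)}.ncard
    · refine Or.inr ⟨(Set.finite_lt_nat N).subset fun n hn => ?_, hev, N, hle⟩
      exact lt_of_not_ge fun h => hX n h hn
    · refine Or.inl ⟨N, fun n hn => (hN n hn).resolve_right fun h => hev ?_⟩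
      exact (stepRun_flipStep_eventually hX hn).1 h.1
  · rintro (⟨N, hN⟩ | ⟨-, hev, N, hN⟩)
    · exact ⟨N, fun n hn => Or.inl (hN n hn)⟩
    · refine ⟨N, fun n hn => Or.inr ⟨?_, hN n hn⟩⟩
      exact (stepRun_flipStep_eventually (fun m hm => not_isX2_of_isaLe2 (hN m hm)) hn).2 hev
end

section
/- For every k ∈ ℕ, the language L^k has exactly 2^k residual languages; more precisely, for finite words u,v ∈ Σ*, the residual languages L^k|_u and L^k|_v are equal if and only if for every 1 ≤ i ≤ k, the number of occurrences of X_i in u and the number of occurrences of X_i in v have the same parity. -/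
open Classical

lemma wcat_nil {α : Type} (w : Word α) : wcat [] w = w := by
  funext n; simp [wcat]

lemma wcat_cons_zero {α : Type} (c : α) (u : List α) (w : Word α) :
    wcat (c :: u) w 0 = c := by
  simp [wcat]

lemma wcat_cons_succ {α : Type} (c : α) (u : List α) (w : Word α) (n : ℕ) :
    wcat (c :: u) w (n + 1) = wcat u w n := by
  simp [wcat]

lemma eventually_wcat_iff {α : Type} (P : α → Prop) (u : List α) (w : Word α) :
    (∃ N, ∀ n, N ≤ n → P (wcat u w n)) ↔ ∃ N, ∀ n, N ≤ n → P (w n) := by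
  induction u with
  | nil => rw [wcat_nil]
  | cons c u ih =>
    rw [← ih]
    constructor
    · rintro ⟨N, hN⟩
      refine ⟨N, fun n hn => ?_⟩
      rw [← wcat_cons_succ c]
      exact hN _ (by omega)
    · rintro ⟨N, hN⟩
      refine ⟨N + 1, fun n hn => ?_⟩
      obtain ⟨m, rfl⟩ : ∃ m, n = m + 1 := ⟨n - 1, by omega⟩
      rw [wcat_cons_succ]
      exact hN m (by omega)

lemma countX_cons (k i : ℕ) (c : Sig2 k) (u : List (Sig2 k)) :
    countX k i (c :: u) = countX k i u + if isX2 k i c then 1 else 0 := by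
  rcases c with m | c <;> simp [countX, isX2, List.countP_cons]

lemma finite_wcat_and_ncard (k i : ℕ) (u : List (Sig2 k)) (w : Word (Sig2 k))
    (hw : {n | isX2 k i (w n)}.Finite) :
    {n | isX2 k i (wcat u w n)}.Finite ∧
      {n | isX2 k i (wcat u w n)}.ncard = countX k i u + {n | isX2 k i (w n)}.ncard := by
  induction u with
  | nil => simpa [wcat_nil, countX] using hw
  | cons c u ih =>
    obtain ⟨hf, hc⟩ := ih
    have himg : (Nat.succ '' {n | isX2 k i (wcat u w n)}).ncard =
        {n | isX2 k i (wcat u w n)}.ncard :=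
      Set.ncard_image_of_injective _ Nat.succ_injective
    rw [countX_cons]
    by_cases h : isX2 k i c
    · have hs : {n | isX2 k i (wcat (c :: u) w n)} =
          insert 0 (Nat.succ '' {n | isX2 k i (wcat u w n)}) := by
        ext n
        cases n <;> simp [wcat_cons_zero, wcat_cons_succ, h]
      rw [hs, Set.ncard_insert_of_notMem (by simp) (hf.image _), himg, hc, if_pos h]
      exact ⟨(hf.image _).insert _, by omega⟩
    · have hs : {n | isX2 k i (wcat (c :: u) w n)} =
          Nat.succ '' {n | isX2 k i (wcat u w n)} := by
        ext n
        cases n <;> simp [wcat_cons_zero, wcat_cons_succ, h]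
      rw [hs, himg, hc, if_neg h]
      exact ⟨hf.image _, by omega⟩

lemma eventually_isaLe2_finite {k i j : ℕ} {w : Word (Sig2 k)}
    (h : ∃ N, ∀ n, N ≤ n → isaLe2 k j (w n)) : {n | isX2 k i (w n)}.Finite := by
  obtain ⟨N, hN⟩ := h
  refine (Set.finite_lt_nat N).subset fun n hn => ?_
  by_contra hlt
  obtain ⟨m, hm, -⟩ := hN n (not_lt.mp hlt)
  obtain ⟨m', hm', -⟩ := hn
  simp [hm] at hm'

lemma wcat_mem_LL_iff (k i : ℕ) (u : List (Sig2 k)) (w : Word (Sig2 k)) :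
    wcat u w ∈ LL k i ↔
      (∃ N, ∀ n, N ≤ n → isaLe2 k (4 * k - 2 * i) (w n)) ∨
      (Even (countX k i u + {n | isX2 k i (w n)}.ncard) ∧
        ∃ N, ∀ n, N ≤ n → isaLe2 k (4 * k - 2 * i + 1) (w n)) := by
  simp only [LL, Set.mem_ofPred_eq, eventually_wcat_iff]
  refine or_congr Iff.rfl ⟨fun ⟨_, he, ht⟩ => ?_, fun ⟨he, ht⟩ => ?_⟩
  · rw [(finite_wcat_and_ncard k i u w (eventually_isaLe2_finite ht)).2] at he
    exact ⟨he, ht⟩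
  · have h := finite_wcat_and_ncard k i u w (eventually_isaLe2_finite ht)
    exact ⟨h.1, by rwa [h.2], ht⟩

lemma residual_eq_of_parity {k : ℕ} {u v : List (Sig2 k)}
    (h : ∀ i, 1 ≤ i → i ≤ k → (Even (countX k i u) ↔ Even (countX k i v))) :
    Residual (Lbig k) u = Residual (Lbig k) v := by
  ext w
  have hk : 1 ≤ k := by
    rcases w 0 with m | m | m <;> have := m.isLt <;> omega
  have hL : ∀ i, 1 ≤ i → i ≤ k → (wcat u w ∈ LL k i ↔ wcat v w ∈ LL k i) := by
    intro i h1 h2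
    rw [wcat_mem_LL_iff, wcat_mem_LL_iff, Nat.even_add, Nat.even_add, h i h1 h2]
  simp only [Residual, Lbig, ChainLang, Set.mem_ofPred_eq]
  refine or_congr (not_congr (hL 1 le_rfl hk)) (exists_congr fun i => ?_)
  refine and_congr_right fun h1 => and_congr_right fun h2 =>
    and_congr (hL i h1 h2) (and_congr_right fun _ => ?_)
  exact forall_congr' fun j => forall_congr' fun hij => forall_congr' fun hjk =>
    not_congr (hL j (by omega) hjk)

/-- A word that lies in `C j` for `1 ≤ j ≤ m` and for no other `j ≤ n` belongs to the chain
language exactly if `m` is even. -/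
lemma mem_chainLang_iff_even {α : Type} {n m : ℕ} {C : ℕ → Set (Word α)} {w : Word α}
    (hn : 1 ≤ n) (hm : m ≤ n) (h : ∀ j, 1 ≤ j → j ≤ n → (w ∈ C j ↔ j ≤ m)) :
    w ∈ ChainLang n C ↔ Even m := by
  simp only [ChainLang, Set.mem_ofPred_eq, h 1 le_rfl hn]
  constructor
  · rintro (h0 | ⟨i, h1, h2, hi, he, hlast⟩)
    · obtain rfl : m = 0 := by omega
      exact Even.zero
    · have him := (h i h1 h2).mp hi
      rcases him.eq_or_lt with rfl | hlt
      · exact he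
      · exact absurd ((h m (by omega) hm).mpr le_rfl) (hlast m hlt hm)
  · intro he
    by_cases h0 : 1 ≤ m
    · exact .inr ⟨m, h0, hm, (h m h0 hm).mpr le_rfl, he, fun j hj hjn hmem => by
        have := (h j (by omega) hjn).mp hmem
        omega⟩
    · exact .inl h0

lemma const_mem_residual_iff {k i : ℕ} (h1 : 1 ≤ i) (h2 : i ≤ k) (u : List (Sig2 k)) :
    (fun _ => Sum.inr (Sum.inr ⟨4 * k - 2 * i + 1, by omega⟩)) ∈ Residual (Lbig k) u ↔
      (Even (countX k i u) ↔ Even i) := by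
  have hmem : ∀ j, wcat u (fun _ => Sum.inr (Sum.inr ⟨4 * k - 2 * i + 1, by omega⟩)) ∈ LL k j ↔
      4 * k - 2 * i + 1 ≤ 4 * k - 2 * j ∨
        Even (countX k j u) ∧ 4 * k - 2 * i + 1 ≤ 4 * k - 2 * j + 1 := by
    intro j
    rw [wcat_mem_LL_iff]
    have ht : ∀ b, (∃ N : ℕ, ∀ n : ℕ, N ≤ n →
        isaLe2 k b (Sum.inr (Sum.inr ⟨4 * k - 2 * i + 1, by omega⟩))) ↔
          4 * k - 2 * i + 1 ≤ b := by
      intro b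
      constructor
      · rintro ⟨N, hN⟩
        obtain ⟨m, hm, hb⟩ := hN N le_rfl
        simp only [Sum.inr.injEq] at hm
        simpa [← hm] using hb
      · exact fun hb => ⟨0, fun _ _ => ⟨_, rfl, hb⟩⟩
    rw [ht, ht]
    simp [isX2]
  change _ ∈ ChainLang k (LL k) ↔ _
  by_cases he : Even (countX k i u)
  · rw [mem_chainLang_iff_even (m := i) (h1.trans h2) h2]
    · simp [he]
    · intro j hj1 hjk
      rw [hmem]
      constructor
      · omega
      · intro hji
        rcases hji.eq_or_lt with rfl | hlt
        · exact .inr ⟨he, le_rfl⟩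
        · left; omega
  · rw [mem_chainLang_iff_even (m := i - 1) (h1.trans h2) (by omega)]
    · obtain ⟨m, rfl⟩ : ∃ m, i = m + 1 := ⟨i - 1, by omega⟩
      simp [he, Nat.even_add_one]
    · intro j hj1 hjk
      rw [hmem]
      constructor
      · rintro (h | ⟨hj, h⟩)
        · omega
        · have : j ≠ i := by rintro rfl; exact he hj
          omega
      · intro hji
        left; omega

lemma residual_eq_iff_parity {k : ℕ} (u v : List (Sig2 k)) :
    Residual (Lbig k) u = Residual (Lbig k) v ↔
      ∀ i, 1 ≤ i → i ≤ k → (Even (countX k i u) ↔ Even (countX k i v)) := by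
  refine ⟨fun h i h1 h2 => ?_, residual_eq_of_parity⟩
  have hu := const_mem_residual_iff h1 h2 u
  rw [h, const_mem_residual_iff h1 h2 v] at hu
  tauto

lemma countX_map_inl (k : ℕ) (m : Fin k) (l : List (Fin k)) :
    countX k (m + 1) (l.map Sum.inl) = l.count m := by
  induction l with
  | nil => simp [countX]
  | cons a l ih =>
    have hX : isX2 k (m + 1) (Sum.inl a) ↔ a = m := by
      constructor
      · rintro ⟨b, hb, hbm⟩
        obtain rfl := Sum.inl.inj hb
        exact Fin.ext (by omega)
      · rintro rfl
        exact ⟨a, rfl, rfl⟩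
    simp [countX_cons, ih, List.count_cons, hX]

lemma even_countX_toList_iff {k : ℕ} (s : Finset (Fin k)) (m : Fin k) :
    Even (countX k (m + 1) (s.toList.map Sum.inl)) ↔ m ∉ s := by
  rw [countX_map_inl]
  by_cases h : m ∈ s
  · rw [List.count_eq_one_of_mem s.nodup_toList (Finset.mem_toList.mpr h)]
    simp [h]
  · rw [List.count_eq_zero_of_not_mem (by simpa using h)]
    simp [h]

lemma ncard_range_residual (k : ℕ) : (Set.range (Residual (Lbig k))).ncard = 2 ^ k := by
  let r : Finset (Fin k) → Set (Word (Sig2 k)) :=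
    fun s => Residual (Lbig k) (s.toList.map Sum.inl)
  have hinj : Function.Injective r := by
    intro s t hst
    ext m
    have := (residual_eq_iff_parity _ _).mp hst (m + 1) (by omega) m.isLt
    rw [even_countX_toList_iff, even_countX_toList_iff] at this
    exact not_iff_not.mp this
  have hrange : Set.range (Residual (Lbig k)) = Set.range r := by
    apply Set.Subset.antisymm
    · rintro _ ⟨u, rfl⟩
      refine ⟨Finset.univ.filter fun m : Fin k => ¬ Even (countX k (m + 1) u),
        residual_eq_of_parity fun i h1 h2 => ?_⟩
      obtain ⟨m, rfl⟩ : ∃ m : Fin k, i = m + 1 := ⟨⟨i - 1, by omega⟩, by simp; omega⟩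
      rw [even_countX_toList_iff]
      simp
    · rintro _ ⟨s, rfl⟩
      exact ⟨_, rfl⟩
  rw [hrange, ← Set.image_univ, Set.ncard_image_of_injective _ hinj, Set.ncard_univ]
  simp

theorem residuals_of_Lbig (k : ℕ) :
    (Set.range (Residual (Lbig k))).ncard = 2 ^ k ∧
    ∀ u v : List (Sig2 k),
      (Residual (Lbig k) u = Residual (Lbig k) v ↔
        ∀ i, 1 ≤ i → i ≤ k → (Even (countX k i u) ↔ Even (countX k i v))) := by
  exact ⟨ncard_range_residual k, residual_eq_iff_parity⟩
end
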